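/- arXiv:1201.1214 — 9 statements merged into one kernel-verified Lean document; each statement's English description precedes it below -/
import Mathlib

section
/- Let t be a positive integer and let p ∈ [0,1]. Suppose p' ∈ [0,1] satisfies |p' − p| ≥ max{1/t, √(p(1−p)/t)}. Then |p' − p| ≥ √( min{p', 1−p'} / (3t) ). -/
/-- If `X` dominates both `|q - p|` and `p * (1 - p)`, then `3 * X` dominates `q ≤ 1 / 2`. -/
theorem le_three_mul_of_abs_sub_le_of_mul_one_sub_le {p q X : ℝ} (hp0 : 0 ≤ p)
    (hq : q ≤ 1 / 2) (hd : |q - p| ≤ X) (hX : p * (1 - p) ≤ X) : q ≤ 3 * X := by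
  have h1 := (le_abs_self (q - p)).trans hd
  have h2 := (neg_le_abs (q - p)).trans hd
  rcases le_total q p with hqp | hqp
  · rcases le_total p (2 / 3) with h3 | h3
    · nlinarith
    · linarith
  · nlinarith

theorem stmt_0 (t : ℕ) (ht : 0 < t) (p p' : ℝ)
    (hp : p ∈ Set.Icc (0:ℝ) 1) (hp' : p' ∈ Set.Icc (0:ℝ) 1)
    (h : max (1 / (t:ℝ)) (Real.sqrt (p * (1 - p) / t)) ≤ |p' - p|) :
    Real.sqrt (min p' (1 - p') / (3 * t)) ≤ |p' - p| := by
  obtain ⟨hp0, hp1⟩ := hp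
  have ht' : (0 : ℝ) < t := by exact_mod_cast ht
  obtain ⟨h1, h2⟩ := max_le_iff.mp h
  have hd0 := abs_nonneg (p' - p)
  rw [Real.sqrt_le_left hd0, div_le_iff₀ ht'] at h2
  rw [div_le_iff₀ ht'] at h1
  rw [Real.sqrt_le_left hd0, div_le_iff₀ (by positivity)]
  have hd : |p' - p| ≤ |p' - p| ^ 2 * t := by nlinarith
  have key : min p' (1 - p') ≤ 3 * (|p' - p| ^ 2 * t) := by
    rcases le_total p' (1 / 2) with hq | hq
    · exact (min_le_left _ _).trans
        (le_three_mul_of_abs_sub_le_of_mul_one_sub_le hp0 hq hd h2)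
    · refine (min_le_right _ _).trans
        (le_three_mul_of_abs_sub_le_of_mul_one_sub_le (p := 1 - p) (by linarith)
          (by linarith) ?_ (by linarith))
      rwa [sub_sub_sub_cancel_left, abs_sub_comm p p']
  linarith
end

section
/- Let X be a finite set, D a probability distribution on X with D(x) > 0 for all x, and D₁,…,D_N probability distributions on X. Let t be a positive integer, let h : X → {0,1}, and set p = E_{x∼D}[h(x)] and p_i = E_{x∼D_i}[h(x)]. Suppose that for every i ∈ {1,…,N} one has |p_i − p| ≥ max{1/t, √(p_i(1−p_i)/t)}. Then (1/N²) Σ_{i=1}^N Σ_{j=1}^N |⟨D̂_i, D̂_j⟩_D| ≥ 1/(3t). -/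
/-- Weighted Cauchy–Schwarz inequality for a signed combination of functions: the sum of the
absolute correlations with `f` is controlled by the pairwise absolute correlations. -/
lemma sq_sum_abs_le_mul_sum_abs {X ι : Type*} [Fintype X] [Fintype ι] (w : X → ℝ)
    (hw : ∀ x, 0 ≤ w x) (f : X → ℝ) (g : ι → X → ℝ) :
    (∑ i, |∑ x, w x * (f x * g i x)|) ^ 2
      ≤ (∑ x, w x * f x ^ 2) * ∑ i, ∑ j, |∑ x, w x * (g i x * g j x)| := by
  have hs : ∀ a : ℝ, ∃ s : ℝ, |s| = 1 ∧ |a| = s * a := fun a => by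
    rcases abs_choice a with h | h
    · exact ⟨1, by simp, by simpa using h⟩
    · exact ⟨-1, by simp, by simpa using h⟩
  choose s hs using fun i => hs (∑ x, w x * (f x * g i x))
  have hlin : ∑ i, |∑ x, w x * (f x * g i x)| = ∑ x, w x * (f x * ∑ i, s i * g i x) := by
    simp_rw [fun i => (hs i).2, Finset.mul_sum]
    rw [Finset.sum_comm]
    exact Finset.sum_congr rfl fun x _ => Finset.sum_congr rfl fun i _ => by ring
  have hquad : ∑ x, w x * (∑ i, s i * g i x) ^ 2
      = ∑ i, ∑ j, s i * s j * ∑ x, w x * (g i x * g j x) := by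
    simp_rw [sq, Finset.sum_mul_sum, Finset.mul_sum]
    rw [Finset.sum_comm]
    refine Finset.sum_congr rfl fun i _ => ?_
    rw [Finset.sum_comm]
    exact Finset.sum_congr rfl fun j _ => Finset.sum_congr rfl fun x _ => by ring
  rw [hlin]
  calc _ ≤ (∑ x, w x * f x ^ 2) * ∑ x, w x * (∑ i, s i * g i x) ^ 2 :=
        Finset.sum_sq_le_sum_mul_sum_of_sq_le_mul _
          (fun x _ => mul_nonneg (hw x) (sq_nonneg _))
          (fun x _ => mul_nonneg (hw x) (sq_nonneg _)) (fun x _ => by apply le_of_eq; ring)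
    _ ≤ _ := by
        rw [hquad]
        refine mul_le_mul_of_nonneg_left ?_
          (Finset.sum_nonneg fun x _ => mul_nonneg (hw x) (sq_nonneg _))
        refine Finset.sum_le_sum fun i _ => Finset.sum_le_sum fun j _ => ?_
        refine (le_abs_self _).trans_eq ?_
        rw [abs_mul, abs_mul, (hs i).1, (hs j).1, one_mul, one_mul]

/-- A `VSTAT` gap between `q` and `p` controls the variance at `p`. -/
lemma mul_one_sub_le_of_max_le_abs_sub {p q t : ℝ} (ht : 0 < t) (hp : 0 ≤ p) (hp' : p ≤ 1)
    (hq : 0 ≤ q) (hq' : q ≤ 1) (h : max (1 / t) (Real.sqrt (q * (1 - q) / t)) ≤ |q - p|) :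
    p * (1 - p) ≤ 2 * t * |q - p| ^ 2 := by
  obtain ⟨h₁, h₂⟩ := max_le_iff.mp h
  rw [Real.sqrt_le_left (abs_nonneg _), div_le_iff₀ ht] at h₂
  rw [div_le_iff₀ ht] at h₁
  have h₃ : p * (1 - p) - q * (1 - q) ≤ |q - p| := by
    rcases abs_cases (q - p) with ⟨he, _⟩ | ⟨he, _⟩ <;> rw [he] <;> nlinarith
  nlinarith [mul_le_mul_of_nonneg_left h₁ (abs_nonneg (q - p))]

/-- Key claim in the proof of Theorem 3.2: if a boolean query h distinguishes
(with VSTAT(t) tolerance) the reference distribution D from each of D₁,…,D_N,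
then the average (absolute) correlation of D₁,…,D_N relative to D is ≥ 1/(3t). -/
theorem stmt_3 {X : Type*} [Fintype X] (N t : ℕ) (hN : 0 < N) (ht : 0 < t)
    (D : X → ℝ) (hDpos : ∀ x, 0 < D x) (hDsum : ∑ x, D x = 1)
    (Ds : Fin N → X → ℝ) (hDs : ∀ i x, 0 ≤ Ds i x) (hDssum : ∀ i, ∑ x, Ds i x = 1)
    (h : X → ℝ) (hbool : ∀ x, h x = 0 ∨ h x = 1)
    (hdist : ∀ i : Fin N,
      max (1 / (t:ℝ))
          (Real.sqrt ((∑ x, Ds i x * h x) * (1 - ∑ x, Ds i x * h x) / t))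
        ≤ |(∑ x, Ds i x * h x) - ∑ x, D x * h x|) :
    1 / (3 * (t:ℝ))
      ≤ (1 / (N:ℝ) ^ 2) *
          ∑ i, ∑ j, |∑ x, D x * ((Ds i x / D x - 1) * (Ds j x / D x - 1))| := by
  have ht' : (0 : ℝ) < t := by exact_mod_cast ht
  have hN' : (0 : ℝ) < N := by exact_mod_cast hN
  have hh : ∀ x, 0 ≤ h x ∧ h x ≤ 1 ∧ h x ^ 2 = h x := fun x => by
    rcases hbool x with e | e <;> rw [e] <;> norm_num
  have hmean : ∀ w : X → ℝ, (∀ x, 0 ≤ w x) → ∑ x, w x = 1 →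
      0 ≤ ∑ x, w x * h x ∧ ∑ x, w x * h x ≤ 1 := fun w hw hw1 =>
    ⟨Finset.sum_nonneg fun x _ => mul_nonneg (hw x) (hh x).1,
      hw1 ▸ Finset.sum_le_sum fun x _ => mul_le_of_le_one_right (hw x) (hh x).2.1⟩
  obtain ⟨hp, hp'⟩ := hmean D (fun x => (hDpos x).le) hDsum
  set p := ∑ x, D x * h x with hpdef
  have hvar : ∑ x, D x * (h x - p) ^ 2 = p * (1 - p) := by
    calc ∑ x, D x * (h x - p) ^ 2
        = ∑ x, ((1 - 2 * p) * (D x * h x) + p ^ 2 * D x) :=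
          Finset.sum_congr rfl fun x _ => by linear_combination D x * (hh x).2.2
      _ = p * (1 - p) := by
          rw [Finset.sum_add_distrib, ← Finset.mul_sum, ← Finset.mul_sum, hDsum, ← hpdef]
          ring
  have hcorr : ∀ i, ∑ x, D x * ((h x - p) * (Ds i x / D x - 1)) = ∑ x, Ds i x * h x - p :=
    fun i => by
    calc ∑ x, D x * ((h x - p) * (Ds i x / D x - 1))
        = ∑ x, (Ds i x * h x - p * Ds i x - (D x * h x - p * D x)) :=
          Finset.sum_congr rfl fun x _ => by
            have := (hDpos x).ne'
            field_simp
      _ = ∑ x, Ds i x * h x - p := by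
          simp only [Finset.sum_sub_distrib, ← Finset.mul_sum, hDsum, hDssum, ← hpdef]
          ring
  have hcs := sq_sum_abs_le_mul_sum_abs D (fun x => (hDpos x).le) (fun x => h x - p)
    (fun i x => Ds i x / D x - 1)
  simp only [hvar, hcorr] at hcs
  set S := ∑ i, ∑ j, |∑ x, D x * ((Ds i x / D x - 1) * (Ds j x / D x - 1))|
  have hS : 0 ≤ S := Finset.sum_nonneg fun i _ => Finset.sum_nonneg fun j _ => abs_nonneg _
  have hle : ∀ c : ℝ, (∀ i, c ≤ |∑ x, Ds i x * h x - p|) →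
      N * c ≤ ∑ i, |∑ x, Ds i x * h x - p| := fun c hc => by
    simpa using Finset.card_nsmul_le_sum Finset.univ _ c fun i _ => hc i
  have hpos : 0 < ∑ i, |∑ x, Ds i x * h x - p| :=
    lt_of_lt_of_le (by positivity) (hle (1 / t) fun i => (le_max_left _ _).trans (hdist i))
  have hV : 0 < p * (1 - p) := by
    have hprod := (pow_pos hpos 2).trans_le hcs
    exact pos_of_mul_pos_left hprod hS
  have hsqrt := hle (Real.sqrt (p * (1 - p) / (2 * t))) fun i => by
    obtain ⟨hq, hq'⟩ := hmean (Ds i) (hDs i) (hDssum i)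
    rw [Real.sqrt_le_left (abs_nonneg _), div_le_iff₀ (by positivity), mul_comm (_ ^ 2)]
    exact mul_one_sub_le_of_max_le_abs_sub ht' hp hp' hq hq' (hdist i)
  have hlow := (pow_le_pow_left₀ (by positivity) hsqrt 2).trans hcs
  rw [mul_pow, Real.sq_sqrt (by positivity), mul_div_assoc', mul_comm, mul_div_assoc] at hlow
  have hfin := le_of_mul_le_mul_left hlow hV
  rw [one_div_mul_eq_div, le_div_iff₀ (by positivity), one_div_mul_eq_div]
  refine le_trans ?_ hfin
  gcongr
  norm_num
end

section
/- Let X be a finite set, D a probability distribution on X with D(x) > 0 for all x, and D₁,…,D_N probability distributions on X. Let h : X → ℝ satisfy ‖h‖_D ≤ 1, and let τ > 0. Suppose that for every i ∈ {1,…,N} one has |E_{x∼D_i}[h(x)] − E_{x∼D}[h(x)]| ≥ τ. Then (1/N²) Σ_{i=1}^N Σ_{j=1}^N |⟨D̂_i, D̂_j⟩_D| ≥ τ². -/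
/-- For a nonnegative weight `w` and a function `h` whose weighted norm is at most one, the squared
sum of the absolute correlations of `h` with the `f i` is at most the sum of the absolute pairwise
correlations of the `f i`. -/
theorem sq_sum_abs_correlation_le {ι X : Type*} [Fintype ι] [Fintype X]
    (w : X → ℝ) (hw : ∀ x, 0 ≤ w x) (f : ι → X → ℝ) (h : X → ℝ)
    (hh : ∑ x, w x * (h x * h x) ≤ 1) :
    (∑ i, |∑ x, w x * (f i x * h x)|) ^ 2 ≤ ∑ i, ∑ j, |∑ x, w x * (f i x * f j x)| := by
  have hsign : ∀ a : ℝ, ∃ s : ℝ, |s| = 1 ∧ s * a = |a| := by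
    intro a
    rcases abs_cases a with ⟨ha, _⟩ | ⟨ha, _⟩
    · exact ⟨1, by simp, by rw [ha, one_mul]⟩
    · exact ⟨-1, by simp, by rw [ha]; ring⟩
  choose s hs_abs hs_mul using fun i => hsign (∑ x, w x * (f i x * h x))
  let g : X → ℝ := fun x => ∑ i, s i * f i x
  have hgh : ∑ i, |∑ x, w x * (f i x * h x)| = ∑ x, w x * (g x * h x) := by
    simp_rw [← hs_mul, g, Finset.sum_mul, Finset.mul_sum]
    rw [Finset.sum_comm]
    exact Finset.sum_congr rfl fun x _ => Finset.sum_congr rfl fun i _ => by ring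
  have hgg : ∑ x, w x * (g x * g x) = ∑ i, ∑ j, s i * s j * ∑ x, w x * (f i x * f j x) := by
    simp_rw [g, Finset.sum_mul_sum, Finset.mul_sum]
    rw [Finset.sum_comm]
    refine Finset.sum_congr rfl fun i _ => ?_
    rw [Finset.sum_comm]
    exact Finset.sum_congr rfl fun j _ => Finset.sum_congr rfl fun x _ => by ring
  have weighted_sq_nonneg : ∀ u : X → ℝ, ∀ x, 0 ≤ w x * (u x * u x) :=
    fun u x => mul_nonneg (hw x) (mul_self_nonneg _)
  calc (∑ i, |∑ x, w x * (f i x * h x)|) ^ 2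
      = (∑ x, w x * (g x * h x)) ^ 2 := by rw [hgh]
    _ ≤ (∑ x, w x * (g x * g x)) * ∑ x, w x * (h x * h x) :=
        Finset.sum_sq_le_sum_mul_sum_of_sq_le_mul _ (fun x _ => weighted_sq_nonneg g x)
          (fun x _ => weighted_sq_nonneg h x) (fun x _ => le_of_eq (by ring))
    _ ≤ ∑ x, w x * (g x * g x) :=
        mul_le_of_le_one_right (Finset.sum_nonneg fun x _ => weighted_sq_nonneg g x) hh
    _ = ∑ i, ∑ j, s i * s j * ∑ x, w x * (f i x * f j x) := hgg
    _ ≤ ∑ i, ∑ j, |∑ x, w x * (f i x * f j x)| := by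
        refine Finset.sum_le_sum fun i _ => Finset.sum_le_sum fun j _ => ?_
        refine (le_abs_self _).trans_eq ?_
        rw [abs_mul, abs_mul, hs_abs, hs_abs, one_mul, one_mul]

/-- Key claim in the proof of Theorem 3.5: if a query h of D-norm at most 1 distinguishes
the reference distribution D from each of D₁,…,D_N with margin τ,
then the average (absolute) correlation of D₁,…,D_N relative to D is ≥ τ². -/
theorem stmt_4 {X : Type*} [Fintype X] (N : ℕ) (hN : 0 < N)
    (D : X → ℝ) (hDpos : ∀ x, 0 < D x) (hDsum : ∑ x, D x = 1)
    (Ds : Fin N → X → ℝ) (hDs : ∀ i x, 0 ≤ Ds i x) (hDssum : ∀ i, ∑ x, Ds i x = 1)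
    (h : X → ℝ) (hnorm : Real.sqrt (∑ x, D x * (h x * h x)) ≤ 1)
    (τ : ℝ) (hτ : 0 < τ)
    (hdist : ∀ i : Fin N, τ ≤ |(∑ x, Ds i x * h x) - ∑ x, D x * h x|) :
    τ ^ 2
      ≤ (1 / (N:ℝ) ^ 2) *
          ∑ i, ∑ j, |∑ x, D x * ((Ds i x / D x - 1) * (Ds j x / D x - 1))| := by
  have hh : ∑ x, D x * (h x * h x) ≤ 1 := by simpa using hnorm
  have hcorr : ∀ i, ∑ x, D x * ((Ds i x / D x - 1) * h x)
      = (∑ x, Ds i x * h x) - ∑ x, D x * h x := by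
    intro i
    rw [← Finset.sum_sub_distrib]
    refine Finset.sum_congr rfl fun x _ => ?_
    have := (hDpos x).ne'
    field_simp
  have hsum : N * τ ≤ ∑ i, |∑ x, D x * ((Ds i x / D x - 1) * h x)| := by
    simpa [hcorr] using Finset.sum_le_sum fun i (_ : i ∈ Finset.univ) => hdist i
  have hN' : (0 : ℝ) < N := Nat.cast_pos.mpr hN
  rw [one_div_mul_eq_div, le_div_iff₀ (by positivity)]
  calc τ ^ 2 * (N : ℝ) ^ 2 = (N * τ) ^ 2 := by ring
    _ ≤ (∑ i, |∑ x, D x * ((Ds i x / D x - 1) * h x)|) ^ 2 :=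
        pow_le_pow_left₀ (by positivity) hsum 2
    _ ≤ _ := sq_sum_abs_correlation_le D (fun x => (hDpos x).le)
        (fun i x => Ds i x / D x - 1) h hh
end

section
/- Let X be a finite set, D a probability distribution on X with D(x) > 0 for all x, and D₁,…,D_m probability distributions on X. Let 0 ≤ γ ≤ β and suppose |⟨D̂_i, D̂_i⟩_D| ≤ β for every i and |⟨D̂_i, D̂_j⟩_D| ≤ γ for every i ≠ j. Let h : X → ℝ with ‖h‖_D ≤ 1 and let τ > 0 satisfy τ² > γ. Then the number of indices i ∈ {1,…,m} with |E_{x∼D_i}[h(x)] − E_{x∼D}[h(x)]| ≥ τ is at most (β − γ)/(τ² − γ). -/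
open scoped Classical

/-- Vectors with squared norms at most `β` and pairwise correlations at most `γ` have a signed sum
of squared norm at most `n β + n (n - 1) γ`. -/
theorem weighted_sq_signed_sum_le {X ι : Type*} [Fintype X] (w : X → ℝ) (f : ι → X → ℝ)
    (s : ι → ℝ) (hs : ∀ i, |s i| = 1) (S : Finset ι) (γ β : ℝ)
    (hdiag : ∀ i, |∑ x, w x * (f i x * f i x)| ≤ β)
    (hoff : ∀ i j, i ≠ j → |∑ x, w x * (f i x * f j x)| ≤ γ) :
    ∑ x, w x * (∑ i ∈ S, s i * f i x) ^ 2 ≤ S.card * (β + (S.card - 1) * γ) := by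
  have expand : ∑ x, w x * (∑ i ∈ S, s i * f i x) ^ 2
      = ∑ i ∈ S, ∑ j ∈ S, s i * s j * ∑ x, w x * (f i x * f j x) := by
    simp_rw [sq, Finset.sum_mul_sum, Finset.mul_sum]
    rw [Finset.sum_comm]
    refine Finset.sum_congr rfl fun i _ => ?_
    rw [Finset.sum_comm]
    exact Finset.sum_congr rfl fun j _ => Finset.sum_congr rfl fun x _ => by ring
  have entry (i j : ι) : s i * s j * ∑ x, w x * (f i x * f j x)
      ≤ γ + if i = j then β - γ else 0 := by
    refine (le_abs_self _).trans ?_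
    rw [abs_mul, abs_mul, hs, hs, one_mul, one_mul]
    split_ifs with hij
    · subst hij
      linarith [hdiag i]
    · linarith [hoff i j hij]
  calc _ ≤ ∑ i ∈ S, ∑ j ∈ S, (γ + if i = j then β - γ else 0) := by
        rw [expand]
        exact Finset.sum_le_sum fun i _ => Finset.sum_le_sum fun j _ => entry i j
    _ = ∑ i ∈ S, (S.card * γ + (β - γ)) := by
        refine Finset.sum_congr rfl fun i hi => ?_
        simp [Finset.sum_add_distrib, hi]
    _ = _ := by
        rw [Finset.sum_const, nsmul_eq_mul]
        ring

/-- Core of Corollary 3.12: a single bounded query h can distinguish the reference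
distribution D with margin τ from at most (β − γ)/(τ² − γ) of m distributions with
pairwise correlations (γ, β). -/
theorem stmt_6 {X : Type*} [Fintype X] (m : ℕ)
    (D : X → ℝ) (hDpos : ∀ x, 0 < D x) (hDsum : ∑ x, D x = 1)
    (Ds : Fin m → X → ℝ) (hDs : ∀ i x, 0 ≤ Ds i x) (hDssum : ∀ i, ∑ x, Ds i x = 1)
    (γ β : ℝ) (hγ : 0 ≤ γ) (hγβ : γ ≤ β)
    (hdiag : ∀ i, |∑ x, D x * ((Ds i x / D x - 1) * (Ds i x / D x - 1))| ≤ β)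
    (hoff : ∀ i j, i ≠ j → |∑ x, D x * ((Ds i x / D x - 1) * (Ds j x / D x - 1))| ≤ γ)
    (h : X → ℝ) (hnorm : Real.sqrt (∑ x, D x * (h x * h x)) ≤ 1)
    (τ : ℝ) (hτ : 0 < τ) (hτγ : γ < τ ^ 2) :
    ((Finset.univ.filter
        (fun i : Fin m => τ ≤ |(∑ x, Ds i x * h x) - ∑ x, D x * h x|)).card : ℝ)
      ≤ (β - γ) / (τ ^ 2 - γ) := by
  set S := Finset.univ.filter
    (fun i : Fin m => τ ≤ |(∑ x, Ds i x * h x) - ∑ x, D x * h x|)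
  set gap : Fin m → ℝ := fun i => (∑ x, Ds i x * h x) - ∑ x, D x * h x with hgap
  have gap_eq (i : Fin m) : gap i = ∑ x, D x * (h x * (Ds i x / D x - 1)) := by
    simp only [hgap]
    rw [← Finset.sum_sub_distrib]
    refine Finset.sum_congr rfl fun x _ => ?_
    have := (hDpos x).ne'
    field_simp
  set s : Fin m → ℝ := fun i => if 0 ≤ gap i then 1 else -1 with hs
  have s_abs (i : Fin m) : |s i| = 1 := by
    simp only [hs]
    split_ifs <;> simp
  have s_mul (i : Fin m) : s i * gap i = |gap i| := by
    simp only [hs]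
    split_ifs with hi
    · rw [one_mul, abs_of_nonneg hi]
    · rw [abs_of_neg (not_le.mp hi), neg_one_mul]
  set g : X → ℝ := fun x => ∑ i ∈ S, s i * (Ds i x / D x - 1) with hg
  have lower : S.card * τ ≤ ∑ x, D x * (h x * g x) := by
    calc (S.card : ℝ) * τ = ∑ i ∈ S, τ := by simp
      _ ≤ ∑ i ∈ S, s i * gap i := by
          refine Finset.sum_le_sum fun i hi => ?_
          rw [s_mul]
          exact (Finset.mem_filter.mp hi).2
      _ = ∑ x, D x * (h x * g x) := by
          simp_rw [gap_eq, hg, Finset.mul_sum]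
          rw [Finset.sum_comm]
          exact Finset.sum_congr rfl fun x _ => Finset.sum_congr rfl fun i _ => by ring
  have cauchy : (∑ x, D x * (h x * g x)) ^ 2
      ≤ (∑ x, D x * (h x * h x)) * ∑ x, D x * g x ^ 2 :=
    Finset.sum_sq_le_sum_mul_sum_of_sq_le_mul _
      (fun x _ => mul_nonneg (hDpos x).le (mul_self_nonneg _))
      (fun x _ => mul_nonneg (hDpos x).le (sq_nonneg _)) (fun x _ => le_of_eq (by ring))
  have norm_le : ∑ x, D x * (h x * h x) ≤ 1 := by simpa using hnorm
  have g_nonneg : 0 ≤ ∑ x, D x * g x ^ 2 :=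
    Finset.sum_nonneg fun x _ => mul_nonneg (hDpos x).le (sq_nonneg _)
  have upper : ∑ x, D x * g x ^ 2 ≤ S.card * (β + (S.card - 1) * γ) :=
    weighted_sq_signed_sum_le D (fun i x => Ds i x / D x - 1) s s_abs S γ β hdiag hoff
  have main : (S.card * τ) ^ 2 ≤ S.card * (β + (S.card - 1) * γ) :=
    (pow_le_pow_left₀ (by positivity) lower 2).trans
      (cauchy.trans ((mul_le_of_le_one_left g_nonneg norm_le).trans upper))
  rw [le_div_iff₀ (sub_pos.mpr hτγ)]
  rcases (Nat.cast_nonneg (α := ℝ) S.card).eq_or_lt with h0 | hpos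
  · rw [← h0, zero_mul]
    exact sub_nonneg.mpr hγβ
  · have : (S.card : ℝ) * τ ^ 2 ≤ β + (S.card - 1) * γ :=
      le_of_mul_le_mul_left (by linarith) hpos
    linarith
end

section
/- Let 1 ≤ k ≤ n and let S_i, S_j ⊆ {1,…,n} be sets of size k with λ = |S_i ∩ S_j|. Let D_{S_i}, D_{S_j} be the planted k-biclique distributions on {0,1}^n and let U be the uniform distribution on {0,1}^n. Then ⟨D̂_{S_i}, D̂_{S_j}⟩_U ≤ 2^λ k²/n². -/
/-- The planted k-biclique distribution D_S on {0,1}^n. -/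
noncomputable def bicliqueD (n k : ℕ) (S : Finset (Fin n)) (x : Fin n → Bool) : ℝ :=
  if ∀ i ∈ S, x i = true
  then (1 - (k:ℝ)/n) / 2 ^ n + ((k:ℝ)/n) / 2 ^ (n - k)
  else (1 - (k:ℝ)/n) / 2 ^ n

/-- A subcube of `{0,1}^n` fixing the coordinates in `S` to `1` has `2^(n - |S|)` points. -/
theorem sum_indicator_forall_mem_eq_true (n : ℕ) (S : Finset (Fin n)) :
    ∑ x : Fin n → Bool, (if ∀ i ∈ S, x i = true then (1 : ℝ) else 0) = 2 ^ (n - S.card) := by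
  have hprod (x : Fin n → Bool) : (if ∀ i ∈ S, x i = true then (1 : ℝ) else 0)
      = ∏ i, if i ∈ S → x i = true then (1 : ℝ) else 0 := by
    rw [Finset.prod_ite_zero]
    simp
  have hcoord (i : Fin n) : ∑ b : Bool, (if i ∈ S → b = true then (1 : ℝ) else 0)
      = if i ∈ S then 1 else 2 := by
    by_cases hi : i ∈ S <;> simp [hi]
  simp_rw [hprod]
  rw [← Fintype.prod_sum (fun i (b : Bool) => if i ∈ S → b = true then (1 : ℝ) else 0)]
  simp_rw [hcoord]
  rw [Finset.prod_ite, Finset.prod_const_one, one_mul, Finset.prod_const,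
    Finset.filter_not, Finset.filter_univ_mem, ← Finset.compl_eq_univ_sdiff,
    Finset.card_compl, Fintype.card_fin]

/-- The density of the planted distribution relative to the uniform one, minus one. -/
theorem bicliqueD_div_uniform_sub_one (n k : ℕ) (hkn : k ≤ n) (S : Finset (Fin n))
    (x : Fin n → Bool) :
    bicliqueD n k S x / ((1 : ℝ) / 2 ^ n) - 1
      = (k : ℝ) / n * (2 ^ k * (if ∀ i ∈ S, x i = true then (1 : ℝ) else 0) - 1) := by
  have h2 : (2 : ℝ) ^ n = 2 ^ (n - k) * 2 ^ k := by rw [← pow_add, Nat.sub_add_cancel hkn]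
  have h3 : (2 : ℝ) ^ (n - k) ≠ 0 := by positivity
  have h4 : (2 : ℝ) ^ k ≠ 0 := by positivity
  unfold bicliqueD
  rw [h2]
  generalize (k : ℝ) / n = c
  split_ifs
  · field_simp
    ring
  · field_simp
    ring

/-- Lemma 5.1: the correlation of two planted biclique distributions relative to
the uniform distribution is at most 2^λ k²/n², λ = |S_i ∩ S_j|. -/
theorem stmt_10 (n k : ℕ) (hk : 1 ≤ k) (hkn : k ≤ n)
    (Si Sj : Finset (Fin n)) (hSi : Si.card = k) (hSj : Sj.card = k) :
    ∑ x : Fin n → Bool,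
        ((1:ℝ) / 2 ^ n) *
          ((bicliqueD n k Si x / ((1:ℝ) / 2 ^ n) - 1) *
            (bicliqueD n k Sj x / ((1:ℝ) / 2 ^ n) - 1))
      ≤ 2 ^ ((Si ∩ Sj).card) * (k:ℝ) ^ 2 / (n:ℝ) ^ 2 := by
  have hmul (x : Fin n → Bool) : (if ∀ i ∈ Si, x i = true then (1 : ℝ) else 0)
      * (if ∀ i ∈ Sj, x i = true then (1 : ℝ) else 0)
      = if ∀ i ∈ Si ∪ Sj, x i = true then (1 : ℝ) else 0 := by
    simp only [Finset.forall_mem_union, ite_and, ite_mul, one_mul, zero_mul]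
  have hexpand (x : Fin n → Bool) : ((1:ℝ) / 2 ^ n) *
      ((bicliqueD n k Si x / ((1:ℝ) / 2 ^ n) - 1) * (bicliqueD n k Sj x / ((1:ℝ) / 2 ^ n) - 1))
      = ((k : ℝ) / n) ^ 2 / 2 ^ n *
        (2 ^ k * 2 ^ k * (if ∀ i ∈ Si ∪ Sj, x i = true then (1 : ℝ) else 0)
          - 2 ^ k * (if ∀ i ∈ Si, x i = true then (1 : ℝ) else 0)
          - 2 ^ k * (if ∀ i ∈ Sj, x i = true then (1 : ℝ) else 0) + 1) := by
    rw [bicliqueD_div_uniform_sub_one n k hkn, bicliqueD_div_uniform_sub_one n k hkn, ← hmul]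
    ring
  have hsum : ∑ _x : Fin n → Bool, (1 : ℝ) = 2 ^ n := by simp
  simp_rw [hexpand]
  rw [← Finset.mul_sum, Finset.sum_add_distrib, Finset.sum_sub_distrib, Finset.sum_sub_distrib,
    ← Finset.mul_sum, ← Finset.mul_sum, ← Finset.mul_sum, hsum,
    sum_indicator_forall_mem_eq_true, sum_indicator_forall_mem_eq_true,
    sum_indicator_forall_mem_eq_true, hSi, hSj]
  have hcard := Finset.card_union_add_card_inter Si Sj
  have hle : (Si ∪ Sj).card ≤ n := by simpa using Finset.card_le_univ (Si ∪ Sj)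
  have hunion : (2 : ℝ) ^ k * 2 ^ k * 2 ^ (n - (Si ∪ Sj).card) = 2 ^ n * 2 ^ (Si ∩ Sj).card := by
    rw [← pow_add, ← pow_add, ← pow_add]
    congr 1
    omega
  have hsingle : (2 : ℝ) ^ k * 2 ^ (n - k) = 2 ^ n := by
    rw [← pow_add, Nat.add_sub_cancel' hkn]
  rw [hunion, hsingle]
  calc ((k : ℝ) / n) ^ 2 / 2 ^ n * (2 ^ n * 2 ^ (Si ∩ Sj).card - 2 ^ n - 2 ^ n + 2 ^ n)
      = ((k : ℝ) / n) ^ 2 * (2 ^ (Si ∩ Sj).card - 1) := by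
        generalize (k : ℝ) / n = c
        field_simp
        ring
    _ ≤ ((k : ℝ) / n) ^ 2 * 2 ^ (Si ∩ Sj).card := by
        gcongr
        linarith
    _ = 2 ^ (Si ∩ Sj).card * (k : ℝ) ^ 2 / (n : ℝ) ^ 2 := by ring
end

section
/- Fix δ > 0 and integers n, k with 5 ≤ k, k ≤ n^{1/2−δ}, and n^{2δ} ≥ 2. Fix a k-element subset S of {1,…,n}, let m = C(n,k), and for 0 ≤ j ≤ k let T_j be the family of all k-element subsets S' of {1,…,n} with |S ∩ S'| = j. Then for every 0 ≤ j ≤ k, |T_j| ≤ 2^j·|T_0| / (j!·n^{2δj}), and for every 1 ≤ j ≤ k, Σ_{λ=j}^{k} |T_λ| ≤ 4(m−1)/n^{2δj}. -/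
/-- T_j: the family of all k-element subsets S' of {1,…,n} with |S ∩ S'| = j. -/
def overlapFamily (n k : ℕ) (S : Finset (Fin n)) (j : ℕ) : Finset (Finset (Fin n)) :=
  (Finset.powersetCard k (Finset.univ : Finset (Fin n))).filter
    (fun S' => (S ∩ S').card = j)

theorem overlapFamily_card {n k : ℕ} {S : Finset (Fin n)} (hS : S.card = k) {j : ℕ} (hj : j ≤ k) :
    (overlapFamily n k S j).card = k.choose j * (n - k).choose (k - j) := by
  have hc : Sᶜ.card = n - k := by rw [Finset.card_compl, hS, Fintype.card_fin]
  rw [← hc]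
  nth_rw 2 [← hS]
  rw [← Finset.card_powersetCard, ← Finset.card_powersetCard, ← Finset.card_product]
  refine Finset.card_nbij' (fun T => (S ∩ T, T \ S)) (fun p => p.1 ∪ p.2) ?_ ?_ ?_ ?_
  · intro T hT
    simp only [overlapFamily, Finset.coe_filter, Finset.mem_powersetCard, Set.mem_ofPred_eq] at hT
    obtain ⟨⟨-, hTk⟩, hTj⟩ := hT
    simp only [Finset.coe_product, Set.mem_prod, Finset.mem_coe, Finset.mem_powersetCard]
    refine ⟨⟨Finset.inter_subset_left, hTj⟩, fun x hx => ?_, ?_⟩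
    · exact Finset.mem_compl.2 (Finset.mem_sdiff.1 hx).2
    · rw [Finset.card_sdiff, hTk, hTj]
  · rintro ⟨A, B⟩ h
    simp only [Finset.coe_product, Set.mem_prod, Finset.mem_coe, Finset.mem_powersetCard] at h
    obtain ⟨⟨hA, hAj⟩, hB, hBk⟩ := h
    have hBS : Disjoint S B := (Finset.subset_compl_iff_disjoint_left).1 hB
    simp only [overlapFamily, Finset.coe_filter, Finset.mem_powersetCard, Set.mem_ofPred_eq]
    refine ⟨⟨Finset.subset_univ _, ?_⟩, ?_⟩
    · rw [Finset.card_union_of_disjoint (hBS.mono_left hA), hAj, hBk]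
      omega
    · rw [Finset.inter_union_distrib_left, Finset.inter_eq_right.2 hA,
        Finset.disjoint_iff_inter_eq_empty.1 hBS, Finset.union_empty, hAj]
  · intro T _
    ext x
    simp only [Finset.mem_union, Finset.mem_inter, Finset.mem_sdiff]
    tauto
  · rintro ⟨A, B⟩ h
    simp only [Finset.coe_product, Set.mem_prod, Finset.mem_coe, Finset.mem_powersetCard] at h
    obtain ⟨⟨hA, -⟩, hB, -⟩ := h
    have hBS : Disjoint S B := (Finset.subset_compl_iff_disjoint_left).1 hB
    refine Prod.ext ?_ ?_
    · change S ∩ (A ∪ B) = A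
      rw [Finset.inter_union_distrib_left, Finset.inter_eq_right.2 hA,
        Finset.disjoint_iff_inter_eq_empty.1 hBS, Finset.union_empty]
    · change (A ∪ B) \ S = B
      rw [Finset.union_sdiff_distrib, Finset.sdiff_eq_empty_iff_subset.2 hA, Finset.empty_union,
        Finset.sdiff_eq_self_of_disjoint hBS.symm]

theorem overlapFamily_card_zero_add_one_le {n k : ℕ} (hk : k ≠ 0) {S : Finset (Fin n)}
    (hS : S.card = k) : (overlapFamily n k S 0).card + 1 ≤ n.choose k := by
  have h : overlapFamily n k S 0 ⊂ Finset.powersetCard k Finset.univ := by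
    refine Finset.filter_ssubset.2 ⟨S, ?_, ?_⟩
    · simpa [Finset.mem_powersetCard] using hS
    · rwa [Finset.inter_self, hS]
  simpa using Finset.card_lt_card h

theorem overlapFamily_card_succ_mul {n k : ℕ} {S : Finset (Fin n)} (hS : S.card = k)
    (hn : 2 * k ≤ n) {i : ℕ} (hi : i < k) :
    (overlapFamily n k S (i + 1)).card * ((i + 1) * (n - 2 * k + i + 1)) =
      (overlapFamily n k S i).card * (k - i) ^ 2 := by
  rw [overlapFamily_card hS hi, overlapFamily_card hS hi.le]
  have h₁ := Nat.choose_succ_right_eq k i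
  have h₂ := Nat.choose_succ_right_eq (n - k) (k - (i + 1))
  rw [show k - (i + 1) + 1 = k - i by omega,
    show n - k - (k - (i + 1)) = n - 2 * k + i + 1 by omega] at h₂
  calc _ = (k.choose (i + 1) * (i + 1)) *
        ((n - k).choose (k - (i + 1)) * (n - 2 * k + i + 1)) := by ring
    _ = _ := by rw [h₁, ← h₂]; ring

theorem overlapFamily_card_succ_le {n k : ℕ} {S : Finset (Fin n)} (hS : S.card = k)
    (hn : 4 * k ≤ n) {X : ℝ} (hX : 0 < X) (hkX : (k : ℝ) ^ 2 * X ≤ n) {i : ℕ} (hi : i < k) :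
    ((overlapFamily n k S (i + 1)).card : ℝ) ≤
      2 / ((i + 1) * X) * (overlapFamily n k S i).card := by
  have h : ((overlapFamily n k S (i + 1)).card : ℝ) * ((i + 1) * (n - 2 * k + i + 1)) =
      (overlapFamily n k S i).card * (k - i) ^ 2 := by
    have := overlapFamily_card_succ_mul hS (by omega) hi
    rw [← Nat.cast_inj (R := ℝ)] at this
    push_cast [Nat.cast_sub (show 2 * k ≤ n by omega), Nat.cast_sub hi.le] at this
    exact this
  have hn' : 4 * (k : ℝ) ≤ n := by exact_mod_cast hn
  have hi' : (i : ℝ) < k := by exact_mod_cast hi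
  have hi₀ : (0 : ℝ) ≤ i := i.cast_nonneg
  have hD : (0 : ℝ) < n - 2 * k + i + 1 := by linarith
  have hsq : ((k : ℝ) - i) ^ 2 * X ≤ 2 * (n - 2 * k + i + 1) := by
    have : ((k : ℝ) - i) ^ 2 ≤ k ^ 2 := by gcongr; linarith
    nlinarith
  rw [div_mul_eq_mul_div, le_div_iff₀ (by positivity)]
  refine le_of_mul_le_mul_right ?_ hD
  calc _ = ((overlapFamily n k S (i + 1)).card : ℝ) * ((i + 1) * (n - 2 * k + i + 1)) * X := by
        ring
    _ = (overlapFamily n k S i).card * (((k : ℝ) - i) ^ 2 * X) := by rw [h]; ring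
    _ ≤ (overlapFamily n k S i).card * (2 * (n - 2 * k + i + 1)) := by gcongr
    _ = _ := by ring

theorem overlapFamily_card_le {n k : ℕ} {S : Finset (Fin n)} (hS : S.card = k)
    (hn : 4 * k ≤ n) {X : ℝ} (hX : 0 < X) (hkX : (k : ℝ) ^ 2 * X ≤ n) {j : ℕ} (hj : j ≤ k) :
    ((overlapFamily n k S j).card : ℝ) ≤
      2 ^ j * (overlapFamily n k S 0).card / (j.factorial * X ^ j) := by
  induction j with
  | zero => simp
  | succ i ih =>
    refine (overlapFamily_card_succ_le hS hn hX hkX hj).trans ?_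
    calc _ ≤ 2 / ((i + 1) * X) *
          (2 ^ i * (overlapFamily n k S 0).card / (i.factorial * X ^ i)) := by
          gcongr
          exact ih (by omega)
      _ = _ := by
        rw [Nat.factorial_succ]
        push_cast
        field_simp
        ring

theorem two_pow_le_two_mul_factorial {j : ℕ} (hj : 1 ≤ j) : 2 ^ j ≤ 2 * j.factorial := by
  induction j, hj using Nat.le_induction with
  | base => simp
  | succ j hj ih =>
    rw [pow_succ, Nat.factorial_succ]
    nlinarith [j.factorial_pos]

theorem sum_Icc_inv_pow_le {X : ℝ} (hX : 2 ≤ X) {j k : ℕ} (hjk : j ≤ k) :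
    ∑ i ∈ Finset.Icc j k, (X ^ i)⁻¹ ≤ 2 * (X ^ j)⁻¹ - (X ^ k)⁻¹ := by
  induction k, hjk using Nat.le_induction with
  | base => simp [two_mul]
  | succ k hjk ih =>
    rw [Finset.sum_Icc_succ_top (by omega)]
    have h : 2 * (X ^ (k + 1))⁻¹ ≤ (X ^ k)⁻¹ := by
      have hX₀ : 0 < X := by linarith
      rw [pow_succ, mul_inv, mul_left_comm]
      refine mul_le_of_le_one_right (by positivity) ?_
      rw [← div_eq_mul_inv, div_le_one hX₀]
      exact hX
    linarith

/-- Tail bounds from the proof of Lemma 5.2: |T_j| ≤ 2^j |T_0|/(j! n^{2δj}) and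
Σ_{λ=j}^k |T_λ| ≤ 4(m−1)/n^{2δj}, where m = C(n,k). -/
theorem stmt_12 (δ : ℝ) (hδ : 0 < δ) (n k : ℕ) (hk : 5 ≤ k)
    (hkn : (k:ℝ) ≤ (n:ℝ) ^ ((1:ℝ)/2 - δ)) (hn2 : (2:ℝ) ≤ (n:ℝ) ^ (2 * δ))
    (S : Finset (Fin n)) (hS : S.card = k) :
    (∀ j ≤ k,
      ((overlapFamily n k S j).card : ℝ)
        ≤ 2 ^ j * ((overlapFamily n k S 0).card : ℝ)
            / ((Nat.factorial j : ℝ) * (n:ℝ) ^ (2 * δ * (j:ℝ)))) ∧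
    (∀ j, 1 ≤ j → j ≤ k →
      (∑ lam ∈ Finset.Icc j k, ((overlapFamily n k S lam).card : ℝ))
        ≤ 4 * ((Nat.choose n k : ℝ) - 1) / (n:ℝ) ^ (2 * δ * (j:ℝ))) := by
  have hn₀ : (0 : ℝ) < n := by
    rcases Nat.eq_zero_or_pos n with rfl | h
    · rw [Nat.cast_zero, Real.zero_rpow (by positivity)] at hn2
      norm_num at hn2
    · exact_mod_cast h
  have hpow (j : ℕ) : (n : ℝ) ^ (2 * δ * (j : ℝ)) = ((n : ℝ) ^ (2 * δ)) ^ j :=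
    Real.rpow_mul_natCast hn₀.le _ _
  have hkX : (k : ℝ) ^ 2 * (n : ℝ) ^ (2 * δ) ≤ n := by
    calc _ ≤ ((n : ℝ) ^ ((1 : ℝ) / 2 - δ)) ^ 2 * (n : ℝ) ^ (2 * δ) := by gcongr
      _ = n := by
        rw [← Real.rpow_mul_natCast hn₀.le, ← Real.rpow_add hn₀]
        norm_num
        ring_nf
        exact Real.rpow_one _
  simp only [hpow]
  generalize (n : ℝ) ^ (2 * δ) = X at hn2 hkX
  have hX : 0 < X := by linarith
  have hn : 4 * k ≤ n := by
    have hk' : (5 : ℝ) ≤ k := by exact_mod_cast hk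
    have : 4 * (k : ℝ) ≤ n := by nlinarith
    exact_mod_cast this
  refine ⟨fun j hj => overlapFamily_card_le hS hn hX hkX hj, fun j hj hjk => ?_⟩
  have hT₀ : ((overlapFamily n k S 0).card : ℝ) ≤ n.choose k - 1 := by
    rw [le_sub_iff_add_le]
    exact_mod_cast overlapFamily_card_zero_add_one_le (by omega) hS
  have hm : (0 : ℝ) ≤ n.choose k - 1 := (Nat.cast_nonneg _).trans hT₀
  calc _ ≤ ∑ i ∈ Finset.Icc j k, 2 * ((n.choose k : ℝ) - 1) * (X ^ i)⁻¹ := by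
        refine Finset.sum_le_sum fun i hi => ?_
        rw [Finset.mem_Icc] at hi
        refine (overlapFamily_card_le hS hn hX hkX hi.2).trans ?_
        have hf : (2 : ℝ) ^ i ≤ 2 * i.factorial := by
          exact_mod_cast two_pow_le_two_mul_factorial (hj.trans hi.1)
        rw [← div_eq_mul_inv, ← div_div]
        gcongr
        rw [div_le_iff₀ (by positivity)]
        calc _ ≤ 2 * (i.factorial : ℝ) * (n.choose k - 1) := by gcongr
          _ = _ := by ring
    _ ≤ 2 * ((n.choose k : ℝ) - 1) * (2 * (X ^ j)⁻¹) := by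
        rw [← Finset.mul_sum]
        gcongr
        exact (sum_Icc_inv_pow_le hn2 hjk).trans (sub_le_self _ (by positivity))
    _ = _ := by ring
end

section
/- Fix δ > 0 and integers n, k with 5 ≤ k, k ≤ n^{1/2−δ}, and n^{2δ} ≥ 2; let m = C(n,k). Let ℓ be an integer with 1 ≤ ℓ ≤ k and let A be a family of k-element subsets of {1,…,n} with |A| ≥ 4(m−1)/n^{2ℓδ}. Then (1/|A|²) Σ_{S_i ∈ A} Σ_{S_j ∈ A} |⟨D̂_{S_i}, D̂_{S_j}⟩_U| < 2^{ℓ+2} k²/n², where U is the uniform distribution on {0,1}^n. -/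
/-- The inner product ⟨D̂_S, D̂_T⟩_U of the "hat" functions of two planted biclique
distributions relative to the uniform distribution U on {0,1}^n. -/
noncomputable def bicliqueCorr (n k : ℕ) (S T : Finset (Fin n)) : ℝ :=
  ∑ x : Fin n → Bool,
    ((1:ℝ) / 2 ^ n) *
      ((bicliqueD n k S x / ((1:ℝ) / 2 ^ n) - 1) *
        (bicliqueD n k T x / ((1:ℝ) / 2 ^ n) - 1))

/-- The fraction of points of the cube that are `true` on all of `S` is `2 ^ (-|S|)`. -/
theorem sum_ite_forall_eq_true {n : ℕ} (S : Finset (Fin n)) :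
    (∑ x : Fin n → Bool, if ∀ i ∈ S, x i = true then (1 : ℝ) else 0) * 2 ^ S.card = 2 ^ n := by
  have h : (Finset.univ.filter fun x : Fin n → Bool => ∀ i ∈ S, x i = true)
      = Fintype.piFinset fun i => if i ∈ S then {true} else Finset.univ := by
    ext x
    simp only [Finset.mem_filter, Finset.mem_univ, true_and, Fintype.mem_piFinset]
    refine forall_congr' fun i => ?_
    by_cases hi : i ∈ S <;> simp [hi]
  have hc : ∀ i : Fin n, (if i ∈ S then ({true} : Finset Bool) else Finset.univ).card
      = if i ∈ S then 1 else 2 := by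
    intro i
    split_ifs <;> simp
  have hm : (∏ i : Fin n, if i ∈ S then 1 else 2) * 2 ^ S.card = 2 ^ n := by
    have h2 : 2 ^ S.card = ∏ i : Fin n, if i ∈ S then 2 else 1 := by
      simp [Finset.prod_ite_mem]
    rw [h2, ← Finset.prod_mul_distrib]
    have h3 : ∀ i : Fin n, ((if i ∈ S then 1 else 2) * if i ∈ S then 2 else 1) = 2 := by
      intro i
      split_ifs <;> rfl
    simp [h3]
  rw [Finset.sum_boole, h, Fintype.card_piFinset]
  simp only [hc]
  exact_mod_cast hm

/-- The hat function of a planted biclique distribution. -/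
theorem bicliqueD_div_sub_one {n k : ℕ} (hkn : k ≤ n) (S : Finset (Fin n)) (x : Fin n → Bool) :
    bicliqueD n k S x / ((1 : ℝ) / 2 ^ n) - 1
      = (k : ℝ) / n * (2 ^ k * (if ∀ i ∈ S, x i = true then 1 else 0) - 1) := by
  have h : (2 : ℝ) ^ n = 2 ^ (n - k) * 2 ^ k := by rw [← pow_add, Nat.sub_add_cancel hkn]
  unfold bicliqueD
  split_ifs
  · rw [h]
    field_simp
    ring
  · field_simp
    ring

/-- The correlation of two planted biclique distributions depends only on the intersection. -/
theorem bicliqueCorr_eq {n k : ℕ} (hkn : k ≤ n) {S T : Finset (Fin n)}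
    (hS : S.card = k) (hT : T.card = k) :
    bicliqueCorr n k S T = ((k : ℝ) / n) ^ 2 * (2 ^ (S ∩ T).card - 1) := by
  have hs := sum_ite_forall_eq_true S
  have ht := sum_ite_forall_eq_true T
  have hst := sum_ite_forall_eq_true (S ∪ T)
  have hu : (2 : ℝ) ^ (S ∪ T).card * 2 ^ (S ∩ T).card = 2 ^ k * 2 ^ k := by
    rw [← pow_add, Finset.card_union_add_card_inter, hS, hT, pow_add]
  rw [hS] at hs
  rw [hT] at ht
  set a := ∑ x : Fin n → Bool, if ∀ i ∈ S, x i = true then (1 : ℝ) else 0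
  set b := ∑ x : Fin n → Bool, if ∀ i ∈ T, x i = true then (1 : ℝ) else 0
  set c := ∑ x : Fin n → Bool, if ∀ i ∈ S ∪ T, x i = true then (1 : ℝ) else 0 with hc
  have hprod : ∀ x : Fin n → Bool, (if ∀ i ∈ S ∪ T, x i = true then (1 : ℝ) else 0)
      = (if ∀ i ∈ S, x i = true then 1 else 0) * (if ∀ i ∈ T, x i = true then 1 else 0) := by
    intro x
    simp only [Finset.forall_mem_union, ite_and, ite_mul, one_mul, zero_mul]
  have hcc : c * (2 ^ k * 2 ^ k) = 2 ^ n * 2 ^ (S ∩ T).card := by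
    rw [← hu, ← hst]
    ring
  have hsum : bicliqueCorr n k S T = 1 / 2 ^ n * ((k : ℝ) / n) ^ 2
      * (c * (2 ^ k * 2 ^ k) - a * 2 ^ k - b * 2 ^ k + 2 ^ n) := by
    have h1 : (2 : ℝ) ^ n = ∑ _x : Fin n → Bool, (1 : ℝ) := by simp
    conv_rhs => enter [2, 2]; rw [h1]
    unfold bicliqueCorr
    rw [hc, Finset.sum_mul, Finset.sum_mul, Finset.sum_mul, ← Finset.sum_sub_distrib,
      ← Finset.sum_sub_distrib, ← Finset.sum_add_distrib, Finset.mul_sum]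
    refine Finset.sum_congr rfl fun x _ => ?_
    rw [bicliqueD_div_sub_one hkn, bicliqueD_div_sub_one hkn, hprod]
    ring
  rw [hsum, hcc, hs, ht]
  field_simp
  ring

theorem pow_mul_choose_sub_le {n k j : ℕ} (hkn : k ≤ n) (hj : j ≤ k) :
    n ^ j * (n - j).choose (k - j) ≤ k ^ j * n.choose k := by
  induction j with
  | zero => simp
  | succ j ih =>
    have ih := ih (by omega)
    obtain ⟨a, rfl⟩ : ∃ a, k = j + 1 + a := ⟨k - (j + 1), by omega⟩
    obtain ⟨b, rfl⟩ : ∃ b, n = j + 1 + b := ⟨n - (j + 1), by omega⟩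
    have e1 : j + 1 + b - j = b + 1 := by omega
    have e2 : j + 1 + a - j = a + 1 := by omega
    rw [e1, e2] at ih
    rw [Nat.add_sub_cancel_left, Nat.add_sub_cancel_left]
    have hc := Nat.add_one_mul_choose_eq b a
    have hab : (a + 1) * (j + 1 + b) ≤ (j + 1 + a) * (b + 1) := by nlinarith
    refine le_of_mul_le_mul_left ?_ b.add_one_pos
    calc (b + 1) * ((j + 1 + b) ^ (j + 1) * b.choose a)
        = (j + 1 + b) ^ (j + 1) * ((b + 1) * b.choose a) := by ring
      _ = ((a + 1) * (j + 1 + b)) * ((j + 1 + b) ^ j * (b + 1).choose (a + 1)) := by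
        rw [hc]; ring
      _ ≤ ((j + 1 + a) * (b + 1)) * ((j + 1 + a) ^ j * (j + 1 + b).choose (j + 1 + a)) :=
        Nat.mul_le_mul hab ih
      _ = _ := by ring

theorem card_filter_subset_powersetCard_le {α : Type*} [Fintype α] [DecidableEq α] (k : ℕ)
    (J : Finset α) :
    ((Finset.powersetCard k Finset.univ).filter (J ⊆ ·)).card
      ≤ (Fintype.card α - J.card).choose (k - J.card) := by
  rw [← Finset.card_compl, ← Finset.card_powersetCard]
  refine Finset.card_le_card_of_injOn (· \ J) ?_ ?_
  · intro T hT
    simp only [Finset.coe_filter, Finset.mem_powersetCard, Set.mem_ofPred_eq] at hT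
    simp only [Finset.mem_coe, Finset.mem_powersetCard]
    refine ⟨fun x hx => ?_, by rw [Finset.card_sdiff_of_subset hT.2, hT.1.2]⟩
    simpa using (Finset.mem_sdiff.1 hx).2
  · intro T hT T' hT' h
    simp only [Finset.coe_filter, Set.mem_ofPred_eq] at hT hT'
    rw [← Finset.sdiff_union_of_subset hT.2, ← Finset.sdiff_union_of_subset hT'.2]
    exact congrArg (· ∪ J) h

/-- Union bound for the number of `k`-sets meeting `S` in at least `j` points. -/
theorem card_filter_le_card_inter_le {α : Type*} [Fintype α] [DecidableEq α] (k j : ℕ)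
    (S : Finset α) :
    ((Finset.powersetCard k Finset.univ).filter fun T => j ≤ (S ∩ T).card).card
      ≤ S.card.choose j * (Fintype.card α - j).choose (k - j) := by
  have hsub : ((Finset.powersetCard k Finset.univ).filter fun T => j ≤ (S ∩ T).card)
      ⊆ (Finset.powersetCard j S).biUnion
        fun J => (Finset.powersetCard k Finset.univ).filter (J ⊆ ·) := by
    intro T hT
    rw [Finset.mem_filter] at hT
    obtain ⟨J, hJ, hJc⟩ := Finset.exists_subset_card_eq hT.2
    rw [Finset.mem_biUnion]
    exact ⟨J, Finset.mem_powersetCard.2 ⟨hJ.trans Finset.inter_subset_left, hJc⟩,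
      Finset.mem_filter.2 ⟨hT.1, hJ.trans Finset.inter_subset_right⟩⟩
  refine (Finset.card_le_card hsub).trans ?_
  rw [← Finset.card_powersetCard]
  refine Finset.card_biUnion_le_card_mul _ _ _ fun J hJ => ?_
  rw [← (Finset.mem_powersetCard.1 hJ).2]
  exact card_filter_subset_powersetCard_le k J

/-- Tail bound for the size of the intersection of a `k`-set with a random `k`-set. -/
theorem card_filter_le_card_inter_le_pow {n k j : ℕ} (hk : 0 < k) (hkn : k ≤ n) (hj : j ≤ k)
    {S : Finset (Fin n)} (hS : S.card = k) :
    (((Finset.powersetCard k Finset.univ).filter fun T => j ≤ (S ∩ T).card).card : ℝ)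
      ≤ ((k : ℝ) ^ 2 / n) ^ j / j.factorial * n.choose k := by
  have hn : (0 : ℝ) < n := by exact_mod_cast hk.trans_le hkn
  have h1 : (((Finset.powersetCard k Finset.univ).filter fun T => j ≤ (S ∩ T).card).card : ℝ)
      ≤ (k.choose j : ℝ) * (n - j).choose (k - j) := by
    have := card_filter_le_card_inter_le k j S
    rw [hS, Fintype.card_fin] at this
    exact_mod_cast this
  have h2 : (n : ℝ) ^ j * (n - j).choose (k - j) ≤ (k : ℝ) ^ j * n.choose k := by
    exact_mod_cast pow_mul_choose_sub_le hkn hj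
  have h3 : ((n - j).choose (k - j) : ℝ) ≤ ((k : ℝ) ^ j * n.choose k) / n ^ j := by
    rw [le_div_iff₀ (by positivity), mul_comm]
    exact h2
  calc _ ≤ (k.choose j : ℝ) * (n - j).choose (k - j) := h1
    _ ≤ ((k : ℝ) ^ j / j.factorial) * (((k : ℝ) ^ j * n.choose k) / n ^ j) := by
      gcongr
      exact Nat.choose_le_pow_div j k
    _ = _ := by rw [div_pow]; ring

/-- The average of `2 ^ |S ∩ T|` over a large family of sets `T` is governed by the pairs
with intersection at most `ℓ`. -/
theorem sum_two_pow_card_inter_le {n k ℓ : ℕ} (hk : 0 < k) (hkn : k ≤ n) {q : ℝ}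
    (hq : (k : ℝ) ^ 2 / n ≤ q) (hq2 : 2 * q ≤ 1) {A : Finset (Finset (Fin n))}
    (hA : ∀ T ∈ A, T.card = k) {S : Finset (Fin n)} (hS : S.card = k) :
    ∑ T ∈ A, (2 : ℝ) ^ (S ∩ T).card
      ≤ 2 ^ ℓ * A.card + 3 * ((2 * q) ^ ℓ * n.choose k) := by
  have hq0 : 0 ≤ q := le_trans (by positivity) hq
  have hpoint : ∀ T ∈ A, (2 : ℝ) ^ (S ∩ T).card ≤ 2 ^ ℓ
      + ∑ j ∈ Finset.Icc ℓ k, 2 ^ j * (if j ≤ (S ∩ T).card then 1 else 0) := by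
    intro T hT
    have hnn : ∀ j ∈ Finset.Icc ℓ k, (0 : ℝ) ≤ 2 ^ j * (if j ≤ (S ∩ T).card then 1 else 0) := by
      intro j _
      positivity
    rcases le_total (S ∩ T).card ℓ with h | h
    · have := Finset.sum_nonneg hnn
      have h2 : (2 : ℝ) ^ (S ∩ T).card ≤ 2 ^ ℓ := pow_le_pow_right₀ one_le_two h
      linarith
    · have hm : (S ∩ T).card ∈ Finset.Icc ℓ k :=
        Finset.mem_Icc.2 ⟨h, hS ▸ Finset.card_le_card Finset.inter_subset_left⟩
      have := Finset.single_le_sum hnn hm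
      rw [if_pos le_rfl, mul_one] at this
      have h2 : (0 : ℝ) ≤ 2 ^ ℓ := by positivity
      linarith
  have htail : ∀ j ∈ Finset.Icc ℓ k,
      ∑ T ∈ A, (2 : ℝ) ^ j * (if j ≤ (S ∩ T).card then 1 else 0)
        ≤ (2 * q) ^ ℓ * n.choose k * (1 / j.factorial) := by
    intro j hj
    obtain ⟨hj1, hj2⟩ := Finset.mem_Icc.1 hj
    rw [← Finset.mul_sum, Finset.sum_boole]
    have hsub : (A.filter fun T => j ≤ (S ∩ T).card)
        ⊆ (Finset.powersetCard k Finset.univ).filter fun T => j ≤ (S ∩ T).card :=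
      Finset.filter_subset_filter _ fun T hT =>
        Finset.mem_powersetCard.2 ⟨Finset.subset_univ _, hA T hT⟩
    have hc : ((A.filter fun T => j ≤ (S ∩ T).card).card : ℝ)
        ≤ q ^ j / j.factorial * n.choose k := by
      refine (Nat.cast_le.2 (Finset.card_le_card hsub)).trans
        ((card_filter_le_card_inter_le_pow hk hkn hj2 hS).trans ?_)
      gcongr
    calc _ ≤ (2 : ℝ) ^ j * (q ^ j / j.factorial * n.choose k) := by gcongr
      _ = (2 * q) ^ j * n.choose k * (1 / j.factorial) := by rw [mul_pow]; ring
      _ ≤ _ := by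
        gcongr ?_ * _ * _
        exact pow_le_pow_of_le_one (by positivity) hq2 hj1
  have hexp : ∑ j ∈ Finset.Icc ℓ k, (1 : ℝ) / j.factorial ≤ 3 := by
    have h1 : ∑ j ∈ Finset.Icc ℓ k, (1 : ℝ) / j.factorial
        ≤ ∑ j ∈ Finset.range (k + 1), (1 : ℝ) / j.factorial := by
      refine Finset.sum_le_sum_of_subset_of_nonneg (fun j hj => ?_) fun j _ _ => by positivity
      have := (Finset.mem_Icc.1 hj).2
      exact Finset.mem_range.2 (by omega)
    have h2 := Real.sum_le_exp_of_nonneg zero_le_one (k + 1)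
    simp only [one_pow] at h2
    linarith [Real.exp_one_lt_d9]
  calc _ ≤ ∑ T ∈ A, ((2 : ℝ) ^ ℓ
        + ∑ j ∈ Finset.Icc ℓ k, 2 ^ j * (if j ≤ (S ∩ T).card then 1 else 0)) :=
        Finset.sum_le_sum hpoint
    _ = 2 ^ ℓ * A.card
        + ∑ j ∈ Finset.Icc ℓ k, ∑ T ∈ A, 2 ^ j * (if j ≤ (S ∩ T).card then 1 else 0) := by
      rw [Finset.sum_add_distrib, Finset.sum_comm, Finset.sum_const, nsmul_eq_mul, mul_comm]
    _ ≤ 2 ^ ℓ * A.card + ∑ j ∈ Finset.Icc ℓ k, (2 * q) ^ ℓ * n.choose k * (1 / j.factorial) := by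
      gcongr with j hj
      exact htail j hj
    _ ≤ _ := by
      rw [← Finset.mul_sum, mul_comm 3]
      gcongr

/-- Theorem 5.3 (core): any sufficiently large family A of planted biclique
distributions has average correlation less than 2^{ℓ+2} k²/n². -/
theorem stmt_14 (δ : ℝ) (hδ : 0 < δ) (n k : ℕ) (hk : 5 ≤ k)
    (hkn : (k:ℝ) ≤ (n:ℝ) ^ ((1:ℝ)/2 - δ)) (hn2 : (2:ℝ) ≤ (n:ℝ) ^ (2 * δ))
    (ℓ : ℕ) (hℓ1 : 1 ≤ ℓ) (hℓk : ℓ ≤ k)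
    (A : Finset (Finset (Fin n))) (hAk : ∀ S' ∈ A, S'.card = k)
    (hAsize : 4 * ((Nat.choose n k : ℝ) - 1) / (n:ℝ) ^ (2 * (ℓ:ℝ) * δ) ≤ (A.card : ℝ)) :
    (1 / (A.card : ℝ) ^ 2) * ∑ Si ∈ A, ∑ Sj ∈ A, |bicliqueCorr n k Si Sj|
      < 2 ^ (ℓ + 2) * (k:ℝ) ^ 2 / (n:ℝ) ^ 2 := by
  have hk0 : 0 < k := by omega
  have hkR : (5 : ℝ) ≤ k := by exact_mod_cast hk
  have hn0 : 0 < n := by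
    rcases Nat.eq_zero_or_pos n with rfl | h
    · have := Real.zero_rpow_le_one ((1 : ℝ) / 2 - δ)
      rw [Nat.cast_zero] at hkn
      linarith
    · exact h
  have hnR : (0 : ℝ) < n := by exact_mod_cast hn0
  set N : ℝ := (n : ℝ) ^ (2 * δ) with hN
  have hN0 : 0 < N := by linarith
  have hksq : (k : ℝ) ^ 2 * N ≤ n := by
    calc (k : ℝ) ^ 2 * N ≤ ((n : ℝ) ^ ((1 : ℝ) / 2 - δ)) ^ 2 * N := by gcongr
      _ = (n : ℝ) := by
        rw [← Real.rpow_natCast, ← Real.rpow_mul hnR.le, hN, ← Real.rpow_add hnR]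
        rw [Nat.cast_ofNat, show (1 / 2 - δ) * 2 + 2 * δ = 1 by ring, Real.rpow_one]
  have hq : (k : ℝ) ^ 2 / n ≤ 1 / N := by
    rw [div_le_div_iff₀ hnR hN0]
    linarith
  have hq2 : 2 * (1 / N) ≤ 1 := by
    rw [mul_one_div, div_le_one hN0]
    exact hn2
  have hkltn : k < n := by
    have : (k : ℝ) < n := by nlinarith
    exact_mod_cast this
  have hNpow : (n : ℝ) ^ (2 * (ℓ : ℝ) * δ) = N ^ ℓ := by
    rw [hN, ← Real.rpow_natCast, ← Real.rpow_mul hnR.le]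
    ring_nf
  have hm : (2 : ℝ) ≤ n.choose k := by
    obtain ⟨b, rfl⟩ : ∃ b, n = b + 1 := ⟨n - 1, by omega⟩
    obtain ⟨a, rfl⟩ : ∃ a, k = a + 1 := ⟨k - 1, by omega⟩
    have h1 := Nat.choose_pos (show a ≤ b by omega)
    have h2 := Nat.choose_pos (show a + 1 ≤ b by omega)
    have h3 := Nat.choose_succ_succ b a
    have : 2 ≤ (b + 1).choose (a + 1) := by
      simp only [Nat.succ_eq_add_one] at h3
      omega
    exact_mod_cast this
  rw [hNpow, div_le_iff₀ (by positivity)] at hAsize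
  have hA0 : (0 : ℝ) < A.card := by
    by_contra h
    have : (A.card : ℝ) * N ^ ℓ ≤ 0 :=
      mul_nonpos_of_nonpos_of_nonneg (not_lt.1 h) (by positivity)
    linarith
  have hmA : (1 / N) ^ ℓ * n.choose k ≤ A.card / 2 := by
    rw [one_div, inv_pow, inv_mul_le_iff₀ (by positivity)]
    linarith
  have hrow : ∀ S ∈ A, ∑ T ∈ A, |bicliqueCorr n k S T|
      ≤ ((k : ℝ) / n) ^ 2 * (3 * 2 ^ ℓ * A.card) := by
    intro S hS
    have hcorr : ∀ T ∈ A, |bicliqueCorr n k S T| ≤ ((k : ℝ) / n) ^ 2 * 2 ^ (S ∩ T).card := by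
      intro T hT
      have h1 : (1 : ℝ) ≤ 2 ^ (S ∩ T).card := one_le_pow₀ one_le_two
      rw [bicliqueCorr_eq hkltn.le (hAk S hS) (hAk T hT),
        abs_of_nonneg (mul_nonneg (by positivity) (by linarith))]
      gcongr
      linarith
    refine (Finset.sum_le_sum hcorr).trans ?_
    rw [← Finset.mul_sum]
    gcongr
    refine (sum_two_pow_card_inter_le (ℓ := ℓ) hk0 hkltn.le hq hq2 hAk (hAk S hS)).trans ?_
    have h2 : (2 : ℝ) ^ ℓ * ((1 / N) ^ ℓ * n.choose k) ≤ 2 ^ ℓ * (A.card / 2) := by gcongr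
    have h3 : (0 : ℝ) ≤ 2 ^ ℓ * A.card := by positivity
    rw [mul_pow]
    linarith
  have hsum := Finset.sum_le_sum hrow
  rw [Finset.sum_const, nsmul_eq_mul] at hsum
  calc _ ≤ 1 / (A.card : ℝ) ^ 2
        * (A.card * (((k : ℝ) / n) ^ 2 * (3 * 2 ^ ℓ * A.card))) := by gcongr
    _ = 3 * (2 ^ ℓ * (k : ℝ) ^ 2 / n ^ 2) := by field_simp
    _ < 4 * (2 ^ ℓ * (k : ℝ) ^ 2 / n ^ 2) := by
      gcongr
      norm_num
    _ = _ := by rw [pow_add]; ring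
end

section
/- Fix 0 < q < 1 and q ≤ p ≤ 1, and integers 1 ≤ k ≤ n. Let S_i, S_j ⊆ {1,…,n} be sets of size k with λ = |S_i ∩ S_j|. Let D be the product of n independent Bernoulli(q) variables on {0,1}^n and let D_{S_i}^{p,q}, D_{S_j}^{p,q} be the planted densest subgraph distributions. Then ⟨D̂_{S_i}^{p,q}, D̂_{S_j}^{p,q}⟩_D = (k²/n²)·( (1 + (p−q)²/(q(1−q)))^λ − 1 ). -/
/-- The Bernoulli(q) probability mass of a bit. -/
noncomputable def bern (q : ℝ) (b : Bool) : ℝ := if b then q else 1 - q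

/-- The product of n independent Bernoulli(q) variables on {0,1}^n. -/
noncomputable def prodBern (n : ℕ) (q : ℝ) (x : Fin n → Bool) : ℝ := ∏ i, bern q (x i)

/-- The planted densest subgraph distribution D_S^{p,q} on {0,1}^n. -/
noncomputable def densestD (n k : ℕ) (p q : ℝ) (S : Finset (Fin n)) (x : Fin n → Bool) : ℝ :=
  (1 - (k:ℝ)/n) * prodBern n q x
    + (k:ℝ)/n * ((∏ i ∈ S, bern p (x i)) * ∏ i ∈ Sᶜ, bern q (x i))

theorem bern_pos {q : ℝ} (hq0 : 0 < q) (hq1 : q < 1) (b : Bool) : 0 < bern q b := by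
  cases b <;> simp [bern, hq0, hq1]

theorem prodBern_pos {q : ℝ} (hq0 : 0 < q) (hq1 : q < 1) {n : ℕ} (x : Fin n → Bool) :
    0 < prodBern n q x :=
  Finset.prod_pos fun i _ => bern_pos hq0 hq1 (x i)

/-- The likelihood ratio on the coordinates in `S` of Bernoulli(p) against Bernoulli(q). -/
noncomputable def bernRatio {n : ℕ} (p q : ℝ) (S : Finset (Fin n)) (x : Fin n → Bool) : ℝ :=
  ∏ i ∈ S, bern p (x i) / bern q (x i)

theorem densestD_div_prodBern_sub_one {q : ℝ} (hq0 : 0 < q) (hq1 : q < 1) (p : ℝ) {n : ℕ}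
    (k : ℕ) (S : Finset (Fin n)) (x : Fin n → Bool) :
    densestD n k p q S x / prodBern n q x - 1 = (k : ℝ) / n * (bernRatio p q S x - 1) := by
  have hP := (prodBern_pos hq0 hq1 x).ne'
  have hS : ∏ i ∈ S, bern q (x i) ≠ 0 :=
    Finset.prod_ne_zero_iff.mpr fun i _ => (bern_pos hq0 hq1 (x i)).ne'
  have key : (∏ i ∈ S, bern p (x i)) * ∏ i ∈ Sᶜ, bern q (x i)
      = prodBern n q x * bernRatio p q S x := by
    rw [prodBern, bernRatio, Finset.prod_div_distrib, ← Finset.prod_mul_prod_compl S]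
    field_simp
  rw [densestD, key]
  generalize (k : ℝ) / n = c
  field_simp
  ring

/-- The second moments of the likelihood ratios under the reference distribution. -/
theorem sum_prodBern_mul_bernRatio_mul_bernRatio {q : ℝ} (hq0 : 0 < q) (hq1 : q < 1) (p : ℝ)
    {n : ℕ} (S T : Finset (Fin n)) :
    ∑ x : Fin n → Bool, prodBern n q x * (bernRatio p q S x * bernRatio p q T x)
      = (1 + (p - q) ^ 2 / (q * (1 - q))) ^ (S ∩ T).card := by
  have h1 : 1 - q ≠ 0 := (sub_pos.mpr hq1).ne'
  have hterm (x : Fin n → Bool) :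
      prodBern n q x * (bernRatio p q S x * bernRatio p q T x)
        = ∏ i, bern q (x i) * ((if i ∈ S then bern p (x i) / bern q (x i) else 1)
            * (if i ∈ T then bern p (x i) / bern q (x i) else 1)) := by
    simp only [prodBern, bernRatio, Finset.prod_mul_distrib, Finset.prod_ite_mem,
      Finset.univ_inter]
  have hcoord (i : Fin n) :
      ∑ b : Bool, bern q b * ((if i ∈ S then bern p b / bern q b else 1)
          * (if i ∈ T then bern p b / bern q b else 1))
        = if i ∈ S ∩ T then 1 + (p - q) ^ 2 / (q * (1 - q)) else 1 := by
    by_cases hS : i ∈ S <;> by_cases hT : i ∈ T <;> simp [bern, hS, hT] <;> field_simp <;> ring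
  simp_rw [hterm]
  rw [← Fintype.prod_sum fun (i : Fin n) (b : Bool) =>
    bern q b * ((if i ∈ S then bern p b / bern q b else 1)
      * (if i ∈ T then bern p b / bern q b else 1))]
  simp_rw [hcoord]
  rw [Finset.prod_ite_mem, Finset.univ_inter, Finset.prod_const]

/-- Lemma 5.4: exact correlation formula for planted densest subgraph distributions
relative to the product Bernoulli(q) reference distribution. -/
theorem stmt_15 (q p : ℝ) (hq0 : 0 < q) (hq1 : q < 1) (hqp : q ≤ p) (hp1 : p ≤ 1)
    (n k : ℕ) (hk : 1 ≤ k) (hkn : k ≤ n)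
    (Si Sj : Finset (Fin n)) (hSi : Si.card = k) (hSj : Sj.card = k) :
    ∑ x : Fin n → Bool,
        prodBern n q x *
          ((densestD n k p q Si x / prodBern n q x - 1) *
            (densestD n k p q Sj x / prodBern n q x - 1))
      = (k:ℝ) ^ 2 / (n:ℝ) ^ 2 *
          ((1 + (p - q) ^ 2 / (q * (1 - q))) ^ ((Si ∩ Sj).card) - 1) := by
  have hST := sum_prodBern_mul_bernRatio_mul_bernRatio hq0 hq1 p Si Sj
  have hS := sum_prodBern_mul_bernRatio_mul_bernRatio hq0 hq1 p Si ∅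
  have hT := sum_prodBern_mul_bernRatio_mul_bernRatio hq0 hq1 p ∅ Sj
  have h0 := sum_prodBern_mul_bernRatio_mul_bernRatio hq0 hq1 p (∅ : Finset (Fin n)) ∅
  have hempty (x : Fin n → Bool) : bernRatio p q ∅ x = 1 := Finset.prod_empty
  simp only [hempty, mul_one, one_mul, Finset.inter_empty, Finset.empty_inter,
    Finset.card_empty, pow_zero] at hS hT h0
  have hexpand (x : Fin n → Bool) :
      prodBern n q x * ((densestD n k p q Si x / prodBern n q x - 1) *
          (densestD n k p q Sj x / prodBern n q x - 1))
        = (k : ℝ) ^ 2 / (n : ℝ) ^ 2 *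
          (prodBern n q x * (bernRatio p q Si x * bernRatio p q Sj x)
            - prodBern n q x * bernRatio p q Si x - prodBern n q x * bernRatio p q Sj x
            + prodBern n q x) := by
    rw [densestD_div_prodBern_sub_one hq0 hq1, densestD_div_prodBern_sub_one hq0 hq1, ← div_pow]
    ring
  simp_rw [hexpand]
  rw [← Finset.mul_sum, Finset.sum_add_distrib, Finset.sum_sub_distrib, Finset.sum_sub_distrib,
    hST, hS, hT, h0]
  ring
end

section
/- Let X' be a finite set and D' a probability distribution on X' with D'(x') > 0 for all x'. Let d ≥ 2 be an integer and let c₁,…,c_d : X' → {−1,1} satisfy |E_{x'∼D'}[c_i(x')·c_j(x')]| ≤ 1/d for all i ≠ j. Then for every function f : X' → {−1,1}, the number of indices i ∈ {1,…,d} with Pr_{x'∼D'}[f(x') = c_i(x')] ≥ 1/2 + 1/(2·d^{1/3}) is at most (1 − 1/d)/(d^{−2/3} − 1/d). -/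
open scoped Classical

/-- A correlation version of the Cauchy–Schwarz inequality: if every `v i`, `i ∈ s`, has correlation
at least `τ ≥ 0` with a `±1`-valued `f`, then `(|s| τ)²` is at most the sum of all pairwise
correlations of the `v i`. -/
theorem sq_card_mul_le_sum_correlations {X ι : Type*} [Fintype X] {D : X → ℝ}
    (hD : ∀ x, 0 ≤ D x) (hsum : ∑ x, D x = 1) {f : X → ℝ} (hf : ∀ x, f x = 1 ∨ f x = -1)
    (v : ι → X → ℝ) (s : Finset ι) {τ : ℝ} (hτ : 0 ≤ τ)
    (h : ∀ i ∈ s, τ ≤ ∑ x, D x * (f x * v i x)) :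
    (s.card * τ) ^ 2 ≤ ∑ i ∈ s, ∑ j ∈ s, ∑ x, D x * (v i x * v j x) := by
  have hlow : s.card * τ ≤ ∑ x, D x * (f x * ∑ i ∈ s, v i x) := by
    calc s.card * τ = ∑ _i ∈ s, τ := by simp
      _ ≤ ∑ i ∈ s, ∑ x, D x * (f x * v i x) := Finset.sum_le_sum h
      _ = ∑ x, D x * (f x * ∑ i ∈ s, v i x) := by
        rw [Finset.sum_comm]
        simp only [Finset.mul_sum]
  have hexp : ∑ i ∈ s, ∑ j ∈ s, ∑ x, D x * (v i x * v j x)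
      = ∑ x, D x * (∑ i ∈ s, v i x) ^ 2 := by
    calc _ = ∑ i ∈ s, ∑ x, ∑ j ∈ s, D x * (v i x * v j x) :=
          Finset.sum_congr rfl fun i _ => Finset.sum_comm
      _ = _ := by
        rw [Finset.sum_comm]
        refine Finset.sum_congr rfl fun x _ => ?_
        rw [sq, Finset.sum_mul_sum]
        simp only [Finset.mul_sum]
  have hnonneg : 0 ≤ ∑ x, D x * (∑ i ∈ s, v i x - s.card * τ * f x) ^ 2 :=
    Finset.sum_nonneg fun x _ => mul_nonneg (hD x) (sq_nonneg _)
  have hsq : ∑ x, D x * (∑ i ∈ s, v i x - s.card * τ * f x) ^ 2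
      = ∑ x, D x * (∑ i ∈ s, v i x) ^ 2
        - 2 * (s.card * τ) * ∑ x, D x * (f x * ∑ i ∈ s, v i x) + (s.card * τ) ^ 2 := by
    have hone : (s.card * τ) ^ 2 = ∑ x, (s.card * τ) ^ 2 * D x := by
      rw [← Finset.mul_sum, hsum, mul_one]
    rw [hone, Finset.mul_sum, ← Finset.sum_sub_distrib, ← Finset.sum_add_distrib]
    refine Finset.sum_congr rfl fun x _ => ?_
    have hfx : f x ^ 2 = 1 := by rcases hf x with h | h <;> simp [h]
    linear_combination D x * (s.card * τ) ^ 2 * hfx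
  have hm : 0 ≤ s.card * τ := by positivity
  rw [hexp]
  nlinarith [mul_le_mul_of_nonneg_left hlow hm]

/-- If diagonal entries are at most `1` and off-diagonal ones at most `γ`, the sum of all entries
over `s × s` is at most `|s| (1 + (|s| - 1) γ)`. -/
theorem sum_sum_le_of_diag_of_offDiag {ι : Type*} (a : ι → ι → ℝ) (s : Finset ι) {γ : ℝ}
    (hdiag : ∀ i, a i i ≤ 1) (hoff : ∀ i j, i ≠ j → a i j ≤ γ) :
    ∑ i ∈ s, ∑ j ∈ s, a i j ≤ s.card * (1 + (s.card - 1) * γ) := by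
  have hrow : ∀ i ∈ s, ∑ j ∈ s, a i j ≤ 1 + (s.card - 1) * γ := by
    intro i hi
    rw [← Finset.add_sum_erase s _ hi]
    have h : ∑ j ∈ s.erase i, a i j ≤ (s.erase i).card • γ :=
      Finset.sum_le_card_nsmul _ _ _ fun j hj => hoff i j (Finset.ne_of_mem_erase hj).symm
    rw [nsmul_eq_mul, Finset.cast_card_erase_of_mem hi] at h
    exact add_le_add (hdiag i) h
  exact (Finset.sum_le_card_nsmul s _ _ hrow).trans_eq (nsmul_eq_mul _ _)

/-- For `±1`-valued functions, the agreement probability is `(1 + correlation) / 2`. -/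
theorem agreement_eq_half_one_add_correlation {X : Type*} [Fintype X] {D : X → ℝ}
    (hsum : ∑ x, D x = 1) {f g : X → ℝ} (hf : ∀ x, f x = 1 ∨ f x = -1)
    (hg : ∀ x, g x = 1 ∨ g x = -1) :
    ∑ x, D x * (if f x = g x then (1:ℝ) else 0) = (1 + ∑ x, D x * (f x * g x)) / 2 := by
  have hsplit : (1 + ∑ x, D x * (f x * g x)) / 2 = ∑ x, (D x + D x * (f x * g x)) / 2 := by
    rw [← Finset.sum_div, Finset.sum_add_distrib, hsum]
  rw [hsplit]
  refine Finset.sum_congr rfl fun x _ => ?_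
  rcases hf x with h | h <;> rcases hg x with hx | hx <;> rw [h, hx] <;> norm_num

/-- Theorem B.4 (counting core): for d nearly uncorrelated ±1 functions c₁,…,c_d
(pairwise correlation at most 1/d), any single hypothesis f can agree with at most
(1 − 1/d)/(d^{−2/3} − 1/d) of them on a (1/2 + 1/(2d^{1/3}))-fraction of inputs. -/
theorem stmt_18 {X' : Type*} [Fintype X'] (D' : X' → ℝ)
    (hpos : ∀ x, 0 < D' x) (hsum : ∑ x, D' x = 1)
    (d : ℕ) (hd : 2 ≤ d)
    (c : Fin d → X' → ℝ) (hcpm : ∀ i x, c i x = 1 ∨ c i x = -1)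
    (hcorr : ∀ i j, i ≠ j → |∑ x, D' x * (c i x * c j x)| ≤ 1 / (d:ℝ))
    (f : X' → ℝ) (hf : ∀ x, f x = 1 ∨ f x = -1) :
    ((Finset.univ.filter (fun i : Fin d =>
        1 / 2 + 1 / (2 * (d:ℝ) ^ ((1:ℝ)/3))
          ≤ ∑ x, D' x * (if f x = c i x then (1:ℝ) else 0))).card : ℝ)
      ≤ (1 - 1 / (d:ℝ)) / ((d:ℝ) ^ (-(2:ℝ)/3) - 1 / (d:ℝ)) := by
  have hd1 : (1:ℝ) < d := by exact_mod_cast hd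
  have hd0 : (0:ℝ) < d := by linarith
  set s := Finset.univ.filter (fun i : Fin d =>
        1 / 2 + 1 / (2 * (d:ℝ) ^ ((1:ℝ)/3))
          ≤ ∑ x, D' x * (if f x = c i x then (1:ℝ) else 0))
  set τ : ℝ := 1 / (d:ℝ) ^ ((1:ℝ)/3) with hτ
  have hτ0 : 0 < τ := by positivity
  have hτsq : (d:ℝ) ^ (-(2:ℝ)/3) = τ ^ 2 := by
    rw [hτ, one_div, ← Real.rpow_neg hd0.le, ← Real.rpow_natCast, ← Real.rpow_mul hd0.le]
    norm_num
  have hgap : 0 < (d:ℝ) ^ (-(2:ℝ)/3) - 1 / (d:ℝ) := by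
    rw [sub_pos, one_div, ← Real.rpow_neg_one]
    exact Real.rpow_lt_rpow_of_exponent_lt hd1 (by norm_num)
  have hlow := sq_card_mul_le_sum_correlations (fun x => (hpos x).le) hsum hf c s hτ0.le (by
    intro i hi
    have h := (Finset.mem_filter.mp hi).2
    rw [agreement_eq_half_one_add_correlation hsum hf (hcpm i)] at h
    have h2 : 1 / (2 * (d:ℝ) ^ ((1:ℝ)/3)) = τ / 2 := by
      rw [hτ, div_div, mul_comm]
    linarith)
  have hup := sum_sum_le_of_diag_of_offDiag (fun i j => ∑ x, D' x * (c i x * c j x)) s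
    (γ := 1 / (d:ℝ)) (by
      intro i
      refine le_of_eq ?_
      rw [← hsum]
      refine Finset.sum_congr rfl fun x _ => ?_
      rcases hcpm i x with h | h <;> simp [h])
    (fun i j hij => (le_abs_self _).trans (hcorr i j hij))
  have hmul := hlow.trans hup
  rw [le_div_iff₀ hgap, hτsq]
  rcases s.card.eq_zero_or_pos with h0 | h0
  · rw [h0, Nat.cast_zero, zero_mul, sub_nonneg, div_le_one hd0]
    exact hd1.le
  · have hm : (0:ℝ) < s.card := by exact_mod_cast h0
    refine le_of_mul_le_mul_left ?_ hm
    linarith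
end
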